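/- Every holomorphic isometry of the complex hyperbolic plane is a product of at most four involutions (so the involution length of PU(2,1) is at most 4). Precisely: for every 3×3 complex matrix A with Aᴴ J A = J there exist 3×3 complex matrices I₁, I₂, I₃, I₄ satisfying I_kᴴ J I_k = J and I_k · I_k = 1 for k = 1,…,4, and a nonzero scalar λ ∈ ℂ, such that A = λ · (I₁ I₂ I₃ I₄). (Factors I_k equal to ±1 are allowed, which accounts for products of fewer than four involutions.) -/

import Mathlib

open Matrix

/-- The Hermitian form of signature (2,1) on ℂ³ (ball model). -/
noncomputable def Jball : Matrix (Fin 3) (Fin 3) ℂ := Matrix.diagonal ![1, 1, -1]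

/-- Membership in U(2,1). -/
def InU21 (A : Matrix (Fin 3) (Fin 3) ℂ) : Prop := Aᴴ * Jball * A = Jball

open ComplexConjugate in
/-- The sesquilinear form `⟨x, y⟩ = yᴴ J x`. -/
noncomputable def herm (x y : Fin 3 → ℂ) : ℂ :=
  x 0 * conj (y 0) + x 1 * conj (y 1) - x 2 * conj (y 2)

open ComplexConjugate in
/-- The Hermitian cross product, orthogonal to both arguments for `herm`. -/
noncomputable def hermCross (x y : Fin 3 → ℂ) : Fin 3 → ℂ :=
  ![conj (x 1 * y 2 - x 2 * y 1), conj (x 2 * y 0 - x 0 * y 2), -conj (x 0 * y 1 - x 1 * y 0)]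

/-- The holomorphic involution fixing `u` and acting as `-1` on its orthogonal complement. -/
noncomputable def invol (u : Fin 3 → ℂ) : Matrix (Fin 3) (Fin 3) ℂ :=
  (2 / herm u u) • vecMulVec u (Jball *ᵥ star u) - 1

section Form

open ComplexConjugate

theorem herm_add_left (x y z : Fin 3 → ℂ) : herm (x + y) z = herm x z + herm y z := by
  simp [herm]; ring

theorem herm_smul_left (a : ℂ) (x z : Fin 3 → ℂ) : herm (a • x) z = a * herm x z := by
  simp [herm]; ring

theorem herm_conj (x y : Fin 3 → ℂ) : conj (herm x y) = herm y x := by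
  simp [herm]; ring

theorem herm_add_right (x y z : Fin 3 → ℂ) : herm z (x + y) = herm z x + herm z y := by
  simp [herm]; ring

theorem herm_smul_right (a : ℂ) (x z : Fin 3 → ℂ) : herm z (a • x) = conj a * herm z x := by
  simp [herm]; ring

theorem herm_sub_left (x y z : Fin 3 → ℂ) : herm (x - y) z = herm x z - herm y z := by
  simp [herm]; ring

theorem herm_sub_right (x y z : Fin 3 → ℂ) : herm z (x - y) = herm z x - herm z y := by
  simp [herm]; ring

theorem herm_hermCross_left (x y : Fin 3 → ℂ) : herm x (hermCross x y) = 0 := by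
  simp [herm, hermCross]; ring

theorem herm_hermCross_right (x y : Fin 3 → ℂ) : herm y (hermCross x y) = 0 := by
  simp [herm, hermCross]; ring

theorem hermCross_herm_left (x y : Fin 3 → ℂ) : herm (hermCross x y) x = 0 := by
  rw [← herm_conj, herm_hermCross_left, map_zero]

theorem hermCross_herm_right (x y : Fin 3 → ℂ) : herm (hermCross x y) y = 0 := by
  rw [← herm_conj, herm_hermCross_right, map_zero]

theorem herm_hermCross_self (x y : Fin 3 → ℂ) :
    herm (hermCross x y) (hermCross x y) = herm x y * herm y x - herm x x * herm y y := by
  simp [herm, hermCross]; ring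

theorem herm_eq_dotProduct (x y : Fin 3 → ℂ) : herm x y = star y ⬝ᵥ (Jball *ᵥ x) := by
  simp [herm, Jball, dotProduct, Fin.sum_univ_three, mulVec_diagonal]; ring

theorem eq_zero_of_herm_self_eq_zero {x : Fin 3 → ℂ} (hx : herm x x = 0) (h2 : x 2 = 0) :
    x = 0 := by
  simp only [herm, h2, Complex.mul_conj, zero_mul, sub_zero] at hx
  norm_cast at hx
  have h0 := Complex.normSq_nonneg (x 0)
  have h1 := Complex.normSq_nonneg (x 1)
  ext i
  fin_cases i
  · exact Complex.normSq_eq_zero.mp (by simp only [Fin.zero_eta]; linarith)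
  · exact Complex.normSq_eq_zero.mp (by simp only [Fin.mk_one]; linarith)
  · exact h2

/-- Orthogonal isotropic vectors are proportional. -/
theorem smul_eq_smul_of_herm_eq_zero {x y : Fin 3 → ℂ} (hx : herm x x = 0) (hy : herm y y = 0)
    (hxy : herm x y = 0) : x 2 • y = y 2 • x := by
  have hyx : herm y x = 0 := by rw [← herm_conj, hxy, map_zero]
  rw [← sub_eq_zero]
  apply eq_zero_of_herm_self_eq_zero
  · simp [herm_sub_left, herm_sub_right, herm_smul_left, herm_smul_right, hx, hy, hxy, hyx]
  · simp; ring

end Form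

section Unitary

variable {A B : Matrix (Fin 3) (Fin 3) ℂ}

theorem InU21.mul (hA : InU21 A) (hB : InU21 B) : InU21 (A * B) := by
  unfold InU21 at *
  calc (A * B)ᴴ * Jball * (A * B) = Bᴴ * (Aᴴ * Jball * A) * B := by
        simp only [conjTranspose_mul, Matrix.mul_assoc]
    _ = Jball := by rw [hA, hB]

theorem inU21_one : InU21 1 := by simp [InU21]

theorem Jball_det : Jball.det = -1 := by
  simp [Jball, Fin.prod_univ_three]

theorem InU21.star_det_mul_det (hA : InU21 A) : star A.det * A.det = 1 := by
  have h := congrArg det hA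
  rw [det_mul, det_mul, det_conjTranspose, Jball_det] at h
  linear_combination -h

theorem InU21.det_ne_zero (hA : InU21 A) : A.det ≠ 0 := by
  intro h
  simpa [h] using hA.star_det_mul_det

theorem InU21.herm_mulVec (hA : InU21 A) (x y : Fin 3 → ℂ) :
    herm (A *ᵥ x) (A *ᵥ y) = herm x y := by
  rw [herm_eq_dotProduct, herm_eq_dotProduct, star_mulVec, ← dotProduct_mulVec, mulVec_mulVec,
    mulVec_mulVec, hA]

theorem inU21_of_herm (h : ∀ x y, herm (A *ᵥ x) (A *ᵥ y) = herm x y) : InU21 A := by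
  ext i j
  have := h (Pi.single j 1) (Pi.single i 1)
  rw [herm_eq_dotProduct, herm_eq_dotProduct, star_mulVec, ← dotProduct_mulVec, mulVec_mulVec,
    mulVec_mulVec] at this
  simpa [← Pi.single_star] using this

theorem transpose_mulVec_cross (A : Matrix (Fin 3) (Fin 3) ℂ) (x y : Fin 3 → ℂ) :
    Aᵀ *ᵥ ((A *ᵥ x) ⨯₃ (A *ᵥ y)) = A.det • (x ⨯₃ y) := by
  ext i
  fin_cases i <;>
  · simp [cross_apply, det_fin_three, mulVec, dotProduct, Fin.sum_univ_three]
    ring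

theorem hermCross_eq (x y : Fin 3 → ℂ) : hermCross x y = Jball *ᵥ star (x ⨯₃ y) := by
  ext i
  fin_cases i <;> simp [hermCross, Jball, cross_apply, mulVec_diagonal]

theorem Jball_mul_Jball : Jball * Jball = 1 := by
  rw [Jball, diagonal_mul_diagonal, ← diagonal_one]
  congr 1
  ext i
  fin_cases i <;> simp

theorem InU21.mulVec_hermCross (hA : InU21 A) (hd : A.det = 1) {x y : Fin 3 → ℂ}
    (hx : A *ᵥ x = x) (hy : A *ᵥ y = y) : A *ᵥ hermCross x y = hermCross x y := by
  have h := transpose_mulVec_cross A x y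
  rw [hx, hy, hd, one_smul] at h
  have h' : Aᴴ *ᵥ star (x ⨯₃ y) = star (x ⨯₃ y) := by
    conv_rhs => rw [← h]
    rw [star_mulVec, ← mulVec_transpose]
    rfl
  have hinv : A * (Jball * Aᴴ * Jball) = 1 := by
    rw [mul_eq_one_comm, Matrix.mul_assoc, Matrix.mul_assoc, ← Matrix.mul_assoc Aᴴ, hA,
      Jball_mul_Jball]
  have hc : (Jball * Aᴴ * Jball) *ᵥ hermCross x y = hermCross x y := by
    rw [hermCross_eq, mulVec_mulVec, Matrix.mul_assoc, Jball_mul_Jball, Matrix.mul_one,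
      ← mulVec_mulVec, h']
  conv_lhs => rw [← hc]
  rw [mulVec_mulVec, hinv, one_mulVec]

theorem InU21.eq_one (hA : InU21 A) (hd : A.det = 1) {x y : Fin 3 → ℂ}
    (hx : A *ᵥ x = x) (hy : A *ᵥ y = y) (hxx : herm x x = 0) (hxy : herm x y ≠ 0) : A = 1 := by
  have hc := hA.mulVec_hermCross hd hx hy
  have hcc := herm_hermCross_self x y
  set P : Matrix (Fin 3) (Fin 3) ℂ := (of ![x, y, hermCross x y])ᵀ with hP
  have hdet : P.det ≠ 0 := by
    have : P.det = herm (hermCross x y) (hermCross x y) := by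
      rw [hP, det_transpose, det_fin_three]
      simp [herm, hermCross]
      ring
    rw [this, hcc, hxx, ← herm_conj x y]
    simpa using hxy
  have hAP : A * P = P := by
    ext i j
    fin_cases j
    · exact congrFun hx i
    · exact congrFun hy i
    · exact congrFun hc i
  have hu : IsUnit P := (isUnit_iff_isUnit_det P).mpr hdet.isUnit
  exact hu.mul_right_cancel (by rw [hAP, Matrix.one_mul])

theorem invol_mulVec (u x : Fin 3 → ℂ) :
    invol u *ᵥ x = (2 / herm u u * herm x u) • u - x := by
  rw [invol, sub_mulVec, one_mulVec, smul_mulVec, vecMulVec_mulVec, mul_smul]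
  congr 2
  ext i
  simp [Jball, herm, mulVec_diagonal, dotProduct, Fin.sum_univ_three]
  ring

theorem invol_mul_self {u : Fin 3 → ℂ} (hu : herm u u ≠ 0) : invol u * invol u = 1 := by
  refine ext_of_mulVec_single fun i => ?_
  generalize (Pi.single i 1 : Fin 3 → ℂ) = x
  rw [← mulVec_mulVec, invol_mulVec, invol_mulVec, one_mulVec, herm_sub_left, herm_smul_left]
  ext i
  simp
  field_simp
  ring

theorem inU21_invol {u : Fin 3 → ℂ} (hu : herm u u ≠ 0) : InU21 (invol u) := by
  apply inU21_of_herm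
  intro x y
  simp only [invol_mulVec, herm_sub_left, herm_sub_right, herm_smul_left, herm_smul_right,
    map_mul, map_div₀, herm_conj, map_ofNat]
  field_simp
  ring

/-- Isotropic vectors with nonzero real product are exchanged by an involution. -/
theorem exists_invol_swap {x y : Fin 3 → ℂ} (hx : herm x x = 0) (hy : herm y y = 0)
    (hxy : herm x y ≠ 0) (hr : herm y x = herm x y) :
    ∃ I, InU21 I ∧ I * I = 1 ∧ I *ᵥ x = y ∧ I *ᵥ y = x := by
  have hu : herm (x + y) (x + y) = 2 * herm x y := by
    rw [herm_add_left, herm_add_right, herm_add_right, hx, hy, hr]; ring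
  have hu0 : herm (x + y) (x + y) ≠ 0 := by rw [hu]; simpa using hxy
  refine ⟨invol (x + y), inU21_invol hu0, invol_mul_self hu0, ?_, ?_⟩
  · rw [invol_mulVec, hu, herm_add_right, hx]
    ext i; simp; field_simp; ring
  · rw [invol_mulVec, hu, herm_add_right, hy, hr]
    ext i; simp; field_simp; ring

theorem det_mul_self_of_involution (h : A * A = 1) : A.det * A.det = 1 := by
  rw [← det_mul, h, det_one]

theorem InU21.exists_mulVec_eq_half_smul (hA : InU21 A) {x : Fin 3 → ℂ} (hx0 : x ≠ 0)
    (hx : A *ᵥ x = (2 : ℂ) • x) : ∃ y, y ≠ 0 ∧ A *ᵥ y = (1 / 2 : ℂ) • y := by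
  have h2 : (A - (2 : ℂ) • 1).det = 0 := by
    rw [← exists_mulVec_eq_zero_iff]
    exact ⟨x, hx0, by rw [sub_mulVec, smul_mulVec, one_mulVec, hx, sub_self]⟩
  have h2' : (Aᴴ - (2 : ℂ) • 1).det = 0 := by
    have h := det_conjTranspose (A - (2 : ℂ) • 1)
    rw [h2, conjTranspose_sub, conjTranspose_smul, conjTranspose_one] at h
    simpa using h
  have key : Aᴴ * Jball * (A - (1 / 2 : ℂ) • 1)
      = (-(1 / 2 : ℂ)) • ((Aᴴ - (2 : ℂ) • 1) * Jball) := by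
    rw [Matrix.mul_sub, hA, Matrix.sub_mul, smul_sub]
    simp [smul_smul]
    abel
  have hd := congrArg det key
  rw [det_smul, det_mul, det_mul, det_mul, h2', det_conjTranspose, Jball_det] at hd
  have h0 : (A - (1 / 2 : ℂ) • 1).det = 0 := by
    simpa [hA.det_ne_zero] using hd
  obtain ⟨y, hy0, hy⟩ := exists_mulVec_eq_zero_iff.mpr h0
  refine ⟨y, hy0, ?_⟩
  rw [sub_mulVec, smul_mulVec, one_mulVec, sub_eq_zero] at hy
  exact hy

/-- A loxodromic isometry with eigenvalues `2, ±1, 1/2` is a product of two involutions. -/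
theorem InU21.exists_eq_mul_of_mulVec_eq_two_smul (hA : InU21 A) (hd : A.det * A.det = 1)
    {x : Fin 3 → ℂ} (hx0 : x ≠ 0) (hxx : herm x x = 0) (hx : A *ᵥ x = (2 : ℂ) • x) :
    ∃ I I', InU21 I ∧ I * I = 1 ∧ InU21 I' ∧ I' * I' = 1 ∧ A = I * I' := by
  obtain ⟨y, hy0, hy⟩ := hA.exists_mulVec_eq_half_smul hx0 hx
  have hyy : herm y y = 0 := by
    have h := hA.herm_mulVec y y
    rw [hy, herm_smul_left, herm_smul_right, map_div₀, map_one, map_ofNat] at h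
    linear_combination (-4 / 3 : ℂ) * h
  have hxy : herm x y ≠ 0 := by
    intro h0
    have h := smul_eq_smul_of_herm_eq_zero hxx hyy h0
    have h' := congrArg (A *ᵥ ·) h
    simp only [mulVec_smul, hx, hy] at h'
    have hx2 : x 2 ≠ 0 := fun h2 => hx0 (eq_zero_of_herm_self_eq_zero hxx h2)
    apply hy0
    ext i
    have hi := congrFun h i
    have hi' := congrFun h' i
    simp only [Pi.smul_apply, smul_eq_mul] at hi hi'
    have : x 2 * y i = 0 := by linear_combination (4 / 3 : ℂ) * hi - (2 / 3 : ℂ) * hi'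
    simpa [hx2] using this
  set z : Fin 3 → ℂ := (herm y x)⁻¹ • y with hz
  have hzz : herm z z = 0 := by simp [hz, herm_smul_left, herm_smul_right, hyy]
  have hxz : herm x z = 1 := by
    rw [hz, herm_smul_right, map_inv₀, herm_conj, inv_mul_cancel₀ hxy]
  have hzx : herm z x = 1 := by rw [← herm_conj, hxz, map_one]
  have hAz : A *ᵥ z = (1 / 2 : ℂ) • z := by rw [hz, mulVec_smul, hy, smul_comm]
  obtain ⟨I, hI, hII, hIx, hIz⟩ :=
    exists_invol_swap hxx hzz (by simp [hxz]) (by rw [hxz, hzx])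
  have hIA := hI.mul hA
  refine ⟨I, I * A, hI, hII, hIA, ?_, ?_⟩
  · refine (hIA.mul hIA).eq_one ?_ (x := x) (y := z) ?_ ?_ hxx (by simp [hxz])
    · rw [det_mul, det_mul]
      linear_combination A.det * A.det * det_mul_self_of_involution hII + hd
    · simp [← mulVec_mulVec, hx, mulVec_smul, hIx, hAz, hIz]
    · simp [← mulVec_mulVec, hx, mulVec_smul, hIx, hAz, hIz]
  · rw [← Matrix.mul_assoc, hII, Matrix.one_mul]

/-- A matrix whose associated form vanishes on the isotropic cone is scalar. -/
theorem eq_smul_one_of_herm_eq_zero (h : ∀ x, herm x x = 0 → herm (A *ᵥ x) x = 0) :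
    A = A 0 0 • (1 : Matrix (Fin 3) (Fin 3) ℂ) := by
  have hI : Complex.I * Complex.I = -1 := Complex.I_mul_I
  have a1 := h ![1, 0, 1] (by simp [herm])
  have a2 := h ![-1, 0, 1] (by simp [herm])
  have a3 := h ![Complex.I, 0, 1] (by simp [herm])
  have b1 := h ![0, 1, 1] (by simp [herm])
  have b2 := h ![0, -1, 1] (by simp [herm])
  have b3 := h ![0, Complex.I, 1] (by simp [herm])
  have c1 := h ![3 / 5, 4 / 5, 1] (by simp [herm, map_ofNat]; norm_num)
  have c2 := h ![3 / 5, 4 / 5 * Complex.I, 1] (by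
    simp [herm, map_ofNat]; linear_combination (-16 / 25 : ℂ) * hI)
  simp [herm, mulVec, dotProduct, Fin.sum_univ_three, map_ofNat] at a1 a2 a3 b1 b2 b3 c1 c2
  have h22 : A 2 2 = A 0 0 := by linear_combination -(a1 + a2) / 2
  have h11 : A 1 1 = A 0 0 := by linear_combination (b1 + b2) / 2 + h22
  have s0 : A 0 2 + A 2 0 = 0 := by
    linear_combination Complex.I * (a3 + A 0 0 * hI + h22) + (A 0 2 + A 2 0) * hI
  have s1 : A 1 2 + A 2 1 = 0 := by
    linear_combination Complex.I * (b3 + A 1 1 * hI + h22 - h11) + (A 1 2 + A 2 1) * hI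
  have h02 : A 0 2 = 0 := by linear_combination s0 / 2 + (a1 - a2) / 4
  have h20 : A 2 0 = 0 := by linear_combination s0 - h02
  have h12 : A 1 2 = 0 := by linear_combination s1 / 2 + (b1 - b2) / 4
  have h21 : A 2 1 = 0 := by linear_combination s1 - h12
  rw [h02, h12, h20, h21, h11, h22] at c1 c2
  have t : A 0 1 + A 1 0 = 0 := by linear_combination 25 / 12 * c1
  have t' : A 0 1 - A 1 0 = 0 := by
    linear_combination
      -(25 / 12) * Complex.I * (c2 + 16 / 25 * A 0 0 * hI) + (A 0 1 - A 1 0) * hI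
  have h01 : A 0 1 = 0 := by linear_combination (t + t') / 2
  have h10 : A 1 0 = 0 := by linear_combination (t - t') / 2
  ext i j
  fin_cases i <;> fin_cases j <;> simp [h01, h02, h10, h12, h20, h21, h11, h22]

/-- Given isotropic `x, y` that are not orthogonal, some isotropic vector has nonzero real
products with both. -/
theorem exists_isotropic_real_products {x y : Fin 3 → ℂ} (hx : herm x x = 0) (hy : herm y y = 0)
    (hxy : herm x y ≠ 0) :
    ∃ p, herm p p = 0 ∧ herm p x = 1 ∧ herm p y ≠ 0 ∧ herm y p = herm p y := by
  have hyx : herm y x ≠ 0 := by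
    rw [← herm_conj]; simpa using hxy
  have h1 := hermCross_herm_left x y
  have h2 := hermCross_herm_right x y
  have h3 := herm_hermCross_left x y
  have h4 := herm_hermCross_right x y
  have h5 := herm_hermCross_self x y
  rw [hx, zero_mul, sub_zero] at h5
  have hcx := herm_conj x y
  have hcy := herm_conj y x
  by_cases hs : herm x y + herm y x = 0
  · refine ⟨(herm x y)⁻¹ • x + (herm y x)⁻¹ • y, ?_⟩
    simp only [herm_add_left, herm_add_right, herm_smul_left, herm_smul_right, hx, hy, map_inv₀,
      hcx, hcy]
    have hs' : herm x y = - herm y x := by linear_combination hs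
    rw [hs']
    refine ⟨?_, ?_, ?_, ?_⟩ <;> field_simp <;> simp [hyx]
  · have hs' : herm y x + herm x y ≠ 0 := by rwa [add_comm]
    refine ⟨(-(herm x y * herm y x ^ 2) / (herm x y + herm y x)) • x + (herm y x)⁻¹ • y
      + hermCross x y, ?_⟩
    simp only [herm_add_left, herm_add_right, herm_smul_left, herm_smul_right, hx, hy, map_inv₀,
      map_div₀, map_mul, map_neg, map_add, map_pow, hcx, hcy, h1, h2, h3, h4, h5]
    refine ⟨?_, ?_, ?_, ?_⟩
    · field_simp
      ring
    · field_simp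
      simp
    · simp [hxy, hyx, hs]
    · field_simp
      ring

/-- An element of `U(2,1)` with determinant `±1` that moves an isotropic line to a
non-orthogonal one is a product of four involutions. -/
theorem InU21.exists_four_involutions (hA : InU21 A) (hd : A.det * A.det = 1) {x : Fin 3 → ℂ}
    (hxx : herm x x = 0) (hx : herm (A *ᵥ x) x ≠ 0) :
    ∃ I₁ I₂ I₃ I₄ : Matrix (Fin 3) (Fin 3) ℂ, InU21 I₁ ∧ I₁ * I₁ = 1 ∧ InU21 I₂ ∧ I₂ * I₂ = 1 ∧
      InU21 I₃ ∧ I₃ * I₃ = 1 ∧ InU21 I₄ ∧ I₄ * I₄ = 1 ∧ A = I₁ * I₂ * I₃ * I₄ := by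
  have hx0 : x ≠ 0 := by
    rintro rfl
    simp [herm] at hx
  obtain ⟨p, hpp, hpx, hpy, hyp⟩ := exists_isotropic_real_products hxx
    ((hA.herm_mulVec x x).trans hxx) (by rw [← herm_conj]; simpa using hx)
  have hxp : herm x p = 1 := by rw [← herm_conj, hpx, map_one]
  have hAq : A *ᵥ (A⁻¹ *ᵥ p) = p := by
    rw [mulVec_mulVec, mul_nonsing_inv _ hA.det_ne_zero.isUnit, one_mulVec]
  set q := A⁻¹ *ᵥ p
  have hqq : herm q q = 0 := by rw [← hA.herm_mulVec, hAq, hpp]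
  have hxq : herm x q = herm (A *ᵥ x) p := by rw [← hA.herm_mulVec, hAq]
  have hqx : herm q x = herm p (A *ᵥ x) := by rw [← hA.herm_mulVec, hAq]
  obtain ⟨I₄, h₄, h₄', h₄x, -⟩ := exists_invol_swap hxx hqq (by rwa [hxq, hyp])
    (by rw [hqx, hxq, hyp])
  obtain ⟨I₁, h₁, h₁', h₁p, -⟩ := exists_invol_swap (x := p) (y := (2 : ℂ) • x) hpp
    (by simp [herm_smul_left, herm_smul_right, hxx]) (by simp [herm_smul_right, hpx])
    (by simp [herm_smul_left, herm_smul_right, hpx, hxp, map_ofNat])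
  obtain ⟨I₂, I₃, h₂, h₂', h₃, h₃', hR⟩ :=
    ((h₁.mul hA).mul h₄).exists_eq_mul_of_mulVec_eq_two_smul
      (by
        rw [det_mul, det_mul]
        have e₁ := det_mul_self_of_involution h₁'
        have e₄ := det_mul_self_of_involution h₄'
        calc _ = (I₁.det * I₁.det) * (A.det * A.det) * (I₄.det * I₄.det) := by ring
          _ = 1 := by rw [e₁, hd, e₄]; norm_num) hx0 hxx
      (by rw [← mulVec_mulVec, ← mulVec_mulVec, h₄x, hAq, h₁p])
  refine ⟨I₁, I₂, I₃, I₄, h₁, h₁', h₂, h₂', h₃, h₃', h₄, h₄', ?_⟩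
  calc A = (I₁ * I₁) * A * (I₄ * I₄) := by rw [h₁', h₄', Matrix.one_mul, Matrix.mul_one]
    _ = I₁ * (I₁ * A * I₄) * I₄ := by simp only [Matrix.mul_assoc]
    _ = I₁ * I₂ * I₃ * I₄ := by rw [hR]; simp only [Matrix.mul_assoc]

/-- An element of `U(2,1)` is a unimodular scalar times one of determinant one. -/
theorem InU21.exists_smul_det_eq_one (hA : InU21 A) :
    ∃ (c : ℂ) (B : Matrix (Fin 3) (Fin 3) ℂ), c ≠ 0 ∧ InU21 B ∧ B.det = 1 ∧ A = c • B := by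
  obtain ⟨c, hc⟩ := IsAlgClosed.exists_pow_nat_eq A.det (n := 3) (by norm_num)
  have hc0 : c ≠ 0 := by
    rintro rfl
    exact hA.det_ne_zero (by simpa using hc.symm)
  have hn : ‖c‖ = 1 := by
    have h := congrArg norm hA.star_det_mul_det
    rw [norm_mul, norm_star, norm_one, ← hc, norm_pow, ← pow_add, ← two_mul] at h
    exact (pow_eq_one_iff_of_nonneg (norm_nonneg c) (by norm_num)).mp h
  have hcc : star c * c = 1 := by
    rw [Complex.star_def, Complex.conj_mul', hn]; simp
  refine ⟨c, c⁻¹ • A, hc0, ?_, ?_, ?_⟩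
  · unfold InU21 at *
    have h' : star c⁻¹ * c⁻¹ = 1 := by rw [star_inv₀, ← mul_inv, hcc, inv_one]
    rw [conjTranspose_smul, Matrix.smul_mul, Matrix.smul_mul, Matrix.mul_smul, hA, smul_smul, h',
      one_smul]
  · rw [det_smul, ← hc]
    simp [hc0]
  · rw [smul_smul, mul_inv_cancel₀ hc0, one_smul]

end Unitary

/-- Every holomorphic isometry of the complex hyperbolic plane is a product of at most
four involutions: the involution length of PU(2,1) is at most 4. -/
theorem involution_length_le_four (A : Matrix (Fin 3) (Fin 3) ℂ) (hA : InU21 A) :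
    ∃ (I₁ I₂ I₃ I₄ : Matrix (Fin 3) (Fin 3) ℂ) (c : ℂ),
      c ≠ 0 ∧
      InU21 I₁ ∧ I₁ * I₁ = 1 ∧
      InU21 I₂ ∧ I₂ * I₂ = 1 ∧
      InU21 I₃ ∧ I₃ * I₃ = 1 ∧
      InU21 I₄ ∧ I₄ * I₄ = 1 ∧
      A = c • (I₁ * I₂ * I₃ * I₄) := by
  obtain ⟨c, B, hc, hB, hd, rfl⟩ := hA.exists_smul_det_eq_one
  by_cases h : ∀ x, herm x x = 0 → herm (B *ᵥ x) x = 0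
  · have hs := eq_smul_one_of_herm_eq_zero h
    have h0 : B 0 0 ≠ 0 := by
      intro h0
      apply hB.det_ne_zero
      rw [hs, h0]
      simp
    refine ⟨1, 1, 1, 1, c * B 0 0, mul_ne_zero hc h0, inU21_one, one_mul 1, inU21_one, one_mul 1,
      inU21_one, one_mul 1, inU21_one, one_mul 1, ?_⟩
    simp only [Matrix.mul_one, mul_smul]
    rw [← hs]
  · push Not at h
    obtain ⟨x, hxx, hx⟩ := h
    obtain ⟨I₁, I₂, I₃, I₄, h₁, h₁', h₂, h₂', h₃, h₃', h₄, h₄', hI⟩ :=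
      hB.exists_four_involutions (by rw [hd, one_mul]) hxx hx
    exact ⟨I₁, I₂, I₃, I₄, c, hc, h₁, h₁', h₂, h₂', h₃, h₃', h₄, h₄', by rw [hI]⟩
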